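/- Let n ≥ 1, k₁, k₂, ℓ₁, ℓ₂ > 0, and let j : [0,∞) → [0,∞) be nonincreasing. Let Ψ : ℝ≥0 × ℝ≥0 → ℝ vanish on hyperplanes, be supermodular, satisfy Ψ(tx, b₂) − tΨ(x, b₂) ≤ Ψ(tx, b₁) − tΨ(x, b₁) for all x ≥ 0, 0 ≤ b₁ ≤ b₂, 0 < t < 1, and the symmetric condition in the second variable, and be continuous in each variable with Ψ absolutely continuous in each variable. Then for all measurable f₁, f₂ : ℝⁿ → ℝ with 0 ≤ fᵢ ≤ kᵢ and ∫ fᵢ ≤ ℓᵢ, the Riesz functional satisfies J(f₁, f₂) = ∫∫ Ψ(f₁(x), f₂(y)) j(|x−y|) dx dy ≤ J(k₁·1_{B₁}, k₂·1_{B₂}), where Bᵢ is the centered ball of measure ℓᵢ/kᵢ. -/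

import Mathlib

open MeasureTheory

namespace RieszBalls

/-- signed position with respect to the bisector of `0` and `v` -/
noncomputable def tau {n : ℕ} (v x : EuclideanSpace ℝ (Fin n)) : ℝ :=
  2 * inner ℝ v x / ‖v‖ ^ 2 - 1

/-- reflection exchanging `0` and `v` -/
noncomputable def sg {n : ℕ} (v x : EuclideanSpace ℝ (Fin n)) : EuclideanSpace ℝ (Fin n) :=
  x - tau v x • v

/-- full transfer of mass towards the origin -/
noncomputable def T {n : ℕ} (v : EuclideanSpace ℝ (Fin n)) (f : EuclideanSpace ℝ (Fin n) → ℝ)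
    (x : EuclideanSpace ℝ (Fin n)) : ℝ :=
  if tau v x < 0 then min 1 (f x + f (sg v x))
  else if tau v x = 0 then f x else max (f x + f (sg v x) - 1) 0

variable {n : ℕ}

lemma inner_eq {v : EuclideanSpace ℝ (Fin n)} (hv : v ≠ 0) (x : EuclideanSpace ℝ (Fin n)) :
    inner ℝ v x = (tau v x + 1) * ‖v‖ ^ 2 / 2 := by
  have : ‖v‖ ≠ 0 := norm_ne_zero_iff.2 hv
  unfold tau; field_simp; ring

lemma tau_sg {v : EuclideanSpace ℝ (Fin n)} (hv : v ≠ 0) (x : EuclideanSpace ℝ (Fin n)) :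
    tau v (sg v x) = - tau v x := by
  have h : ‖v‖ ≠ 0 := norm_ne_zero_iff.2 hv
  have h1 : inner ℝ v (sg v x) = (- tau v x + 1) * ‖v‖ ^ 2 / 2 := by
    rw [sg, inner_sub_right, inner_smul_right, real_inner_self_eq_norm_sq, inner_eq hv]; ring
  rw [tau, h1]; field_simp; ring

lemma sg_sg {v : EuclideanSpace ℝ (Fin n)} (hv : v ≠ 0) (x : EuclideanSpace ℝ (Fin n)) :
    sg v (sg v x) = x := by
  rw [sg, tau_sg hv, sg]; simp

lemma norm_sg_sq {v : EuclideanSpace ℝ (Fin n)} (hv : v ≠ 0) (x : EuclideanSpace ℝ (Fin n)) :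
    ‖sg v x‖ ^ 2 = ‖x‖ ^ 2 - tau v x * ‖v‖ ^ 2 := by
  rw [sg, norm_sub_sq_real, inner_smul_right, norm_smul, mul_pow, real_inner_comm, inner_eq hv,
    Real.norm_eq_abs, sq_abs]; ring

lemma norm_sub_sg_sq {v : EuclideanSpace ℝ (Fin n)} (hv : v ≠ 0)
    (x y : EuclideanSpace ℝ (Fin n)) :
    ‖x - sg v y‖ ^ 2 = ‖x - y‖ ^ 2 + tau v x * tau v y * ‖v‖ ^ 2 := by
  have : x - sg v y = (x - y) + tau v y • v := by rw [sg]; abel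
  rw [this, norm_add_sq_real, inner_smul_right, norm_smul, mul_pow, real_inner_comm,
    inner_sub_right, inner_eq hv, inner_eq hv, Real.norm_eq_abs, sq_abs]; ring

lemma sg_eq_refl (v x : EuclideanSpace ℝ (Fin n)) :
    sg v x = -((Submodule.span ℝ {v}).reflection x) + v := by
  rw [Submodule.reflection_singleton_apply, sg, tau]
  simp only [sub_smul, one_smul, neg_sub, two_smul, ← add_smul]
  have : 2 * inner ℝ v x / ‖v‖ ^ 2 = inner ℝ v x / ‖v‖ ^ 2 + inner ℝ v x / ‖v‖ ^ 2 := by ring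
  rw [this]; simp; abel

lemma norm_sg_sub_sg (v x y : EuclideanSpace ℝ (Fin n)) : ‖sg v x - sg v y‖ = ‖x - y‖ := by
  rw [sg_eq_refl, sg_eq_refl]
  have : -((Submodule.span ℝ {v}).reflection x) + v - (-((Submodule.span ℝ {v}).reflection y) + v)
    = - ((Submodule.span ℝ {v}).reflection (x - y)) := by rw [map_sub]; abel
  rw [this, norm_neg, LinearIsometryEquiv.norm_map]

lemma mp_sg (v : EuclideanSpace ℝ (Fin n)) : MeasurePreserving (sg v) volume volume := by
  have h1 := ((Submodule.span ℝ {v}).reflection).measurePreserving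
  have h2 : MeasurePreserving (fun x : EuclideanSpace ℝ (Fin n) => -x) volume volume :=
    Measure.measurePreserving_neg _
  have h3 := measurePreserving_add_right (volume : Measure (EuclideanSpace ℝ (Fin n))) v
  have := h3.comp (h2.comp h1)
  have e : sg v = (fun x => x + v) ∘ (fun x => -x) ∘ (Submodule.span ℝ {v}).reflection :=
    funext fun x => sg_eq_refl v x
  rw [e]; exact this

lemma meas_tau : Measurable (fun p : EuclideanSpace ℝ (Fin n) × EuclideanSpace ℝ (Fin n) =>
    tau p.1 p.2) := by
  unfold tau; fun_prop

lemma meas_sg : Measurable (fun p : EuclideanSpace ℝ (Fin n) × EuclideanSpace ℝ (Fin n) =>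
    sg p.1 p.2) := by
  unfold sg; have := meas_tau (n := n); fun_prop

/-- admissible functions -/
structure Adm (R m : ℝ) (f : EuclideanSpace ℝ (Fin n) → ℝ) : Prop where
  meas : Measurable f
  nonneg : ∀ x, 0 ≤ f x
  le_one : ∀ x, f x ≤ 1
  supp : ∀ x, R ≤ ‖x‖ → f x = 0
  mass : ∫⁻ x, ENNReal.ofReal (f x) ≤ volume (Metric.ball (0 : EuclideanSpace ℝ (Fin n)) m)

lemma T_meas {f : EuclideanSpace ℝ (Fin n) → ℝ} (hf : Measurable f)
    (v : EuclideanSpace ℝ (Fin n)) : Measurable (T v f) := by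
  have h1 : Measurable (tau v) := by
    unfold tau; fun_prop
  have h2 : Measurable (fun x => f (sg v x)) := hf.comp (mp_sg v).measurable
  unfold T
  refine Measurable.ite (measurableSet_lt h1 measurable_const) (measurable_const.min (hf.add h2)) ?_
  exact Measurable.ite (measurableSet_eq_fun h1 measurable_const) hf
    (((hf.add h2).sub_const 1).max measurable_const)

lemma T_nonneg {f : EuclideanSpace ℝ (Fin n) → ℝ} (hf : ∀ x, 0 ≤ f x)
    (v x : EuclideanSpace ℝ (Fin n)) : 0 ≤ T v f x := by
  unfold T
  have := hf x
  have := hf (sg v x)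
  split_ifs
  · positivity
  · assumption
  · exact le_max_right _ _

lemma T_le_one {f : EuclideanSpace ℝ (Fin n) → ℝ} (hf : ∀ x, f x ≤ 1)
    (v x : EuclideanSpace ℝ (Fin n)) : T v f x ≤ 1 := by
  unfold T
  have := hf x
  have := hf (sg v x)
  split_ifs
  · exact min_le_left _ _
  · assumption
  · exact max_le (by linarith) (by norm_num)

lemma sg_of_tau_zero {v x : EuclideanSpace ℝ (Fin n)} (h : tau v x = 0) : sg v x = x := by
  simp [sg, h]

lemma T_sum {v : EuclideanSpace ℝ (Fin n)} (hv : v ≠ 0) (f : EuclideanSpace ℝ (Fin n) → ℝ)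
    (x : EuclideanSpace ℝ (Fin n)) : T v f x + T v f (sg v x) = f x + f (sg v x) := by
  rcases lt_trichotomy (tau v x) 0 with h | h | h
  · simp only [T, tau_sg hv, sg_sg hv]
    rw [if_pos h, if_neg (by linarith), if_neg (by linarith)]
    rcases le_total 1 (f x + f (sg v x)) with h' | h'
    · rw [min_eq_left h', max_eq_left (by linarith)]; ring
    · rw [min_eq_right h', max_eq_right (by linarith)]; ring
  · simp [T, sg_of_tau_zero h, h]
  · simp only [T, tau_sg hv, sg_sg hv]
    rw [if_neg (by linarith), if_neg (by linarith), if_pos (by linarith)]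
    rcases le_total 1 (f x + f (sg v x)) with h' | h'
    · rw [max_eq_left (by linarith), min_eq_left (by linarith)]; ring
    · rw [max_eq_right (by linarith), min_eq_right (by linarith)]; ring

lemma T_diff {v : EuclideanSpace ℝ (Fin n)} (hv : v ≠ 0) {f : EuclideanSpace ℝ (Fin n) → ℝ}
    (h0 : ∀ x, 0 ≤ f x) (h1 : ∀ x, f x ≤ 1) (x : EuclideanSpace ℝ (Fin n)) (h : tau v x < 0) :
    |f x - f (sg v x)| ≤ T v f x - T v f (sg v x) := by
  have a0 := h0 x
  have b0 := h0 (sg v x)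
  have a1 := h1 x
  have b1 := h1 (sg v x)
  simp only [T, tau_sg hv, sg_sg hv]
  rw [if_pos h, if_neg (by linarith), if_neg (by linarith), abs_le]
  rcases le_total 1 (f x + f (sg v x)) with h' | h'
  · rw [min_eq_left h', max_eq_left (by linarith)]; constructor <;> linarith
  · rw [min_eq_right h', max_eq_right (by linarith)]; constructor <;> linarith

/-- the Riesz functional -/
noncomputable def J (k : ℝ → ℝ) (f g : EuclideanSpace ℝ (Fin n) → ℝ) : ENNReal :=
  ∫⁻ p : EuclideanSpace ℝ (Fin n) × EuclideanSpace ℝ (Fin n),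
    ENNReal.ofReal (f p.1 * g p.2 * k ‖p.1 - p.2‖) ∂(volume.prod volume)

lemma four_sum {a a' b b' A A' B B' K1 K2 : ℝ} (hA : A + A' = a + a') (hB : B + B' = b + b')
    (h : (a - a') * (b - b') * (K1 - K2) ≤ (A - A') * (B - B') * (K1 - K2)) :
    a * b * K1 + a' * b' * K1 + a * b' * K2 + a' * b * K2 ≤
    A * B * K1 + A' * B' * K1 + A * B' * K2 + A' * B * K2 := by
  have e1 : a * b * K1 + a' * b' * K1 + a * b' * K2 + a' * b * K2
     = ((a + a') * (b + b') * (K1 + K2) + (a - a') * (b - b') * (K1 - K2)) / 2 := by ring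
  have e2 : A * B * K1 + A' * B' * K1 + A * B' * K2 + A' * B * K2
     = ((A + A') * (B + B') * (K1 + K2) + (A - A') * (B - B') * (K1 - K2)) / 2 := by ring
  rw [e1, e2, hA, hB]; linarith

lemma mul_abs_bd {p q P Q : ℝ} (hp : |p| ≤ P) (hq : |q| ≤ Q) : |p * q| ≤ P * Q := by
  rw [abs_mul]; exact mul_le_mul hp hq (abs_nonneg _) ((abs_nonneg _).trans hp)

lemma key_pt {k : ℝ → ℝ} (hk : Antitone k) {v : EuclideanSpace ℝ (Fin n)} (hv : v ≠ 0)
    {f g : EuclideanSpace ℝ (Fin n) → ℝ}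
    (f0 : ∀ x, 0 ≤ f x) (f1 : ∀ x, f x ≤ 1) (g0 : ∀ x, 0 ≤ g x) (g1 : ∀ x, g x ≤ 1)
    (x y : EuclideanSpace ℝ (Fin n)) :
    (f x - f (sg v x)) * (g y - g (sg v y)) * (k ‖x - y‖ - k ‖x - sg v y‖) ≤
    (T v f x - T v f (sg v x)) * (T v g y - T v g (sg v y)) *
      (k ‖x - y‖ - k ‖x - sg v y‖) := by
  have hn := norm_sub_sg_sq hv x y
  have hv2 : 0 < ‖v‖ ^ 2 := by positivity
  have neg : ∀ {h : EuclideanSpace ℝ (Fin n) → ℝ}, (∀ x, 0 ≤ h x) → (∀ x, h x ≤ 1) → ∀ z,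
      0 < tau v z → |h z - h (sg v z)| ≤ - (T v h z - T v h (sg v z)) := by
    intro h h0 h1 z hz
    have := T_diff hv h0 h1 (sg v z) (by rw [tau_sg hv]; linarith)
    rw [sg_sg hv, abs_sub_comm] at this
    linarith
  have same : 0 < tau v x * tau v y → k ‖x - sg v y‖ ≤ k ‖x - y‖ := by
    intro h; apply hk; apply le_of_sq_le_sq _ (norm_nonneg _)
    nlinarith [mul_pos h hv2]
  have opp : tau v x * tau v y < 0 → k ‖x - y‖ ≤ k ‖x - sg v y‖ := by
    intro h; apply hk; apply le_of_sq_le_sq _ (norm_nonneg _)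
    nlinarith [mul_pos (neg_pos.2 h) hv2]
  rcases lt_trichotomy (tau v x) 0 with hx | hx | hx
  · have tx := T_diff hv f0 f1 x hx
    rcases lt_trichotomy (tau v y) 0 with hy | hy | hy
    · have ty := T_diff hv g0 g1 y hy
      exact mul_le_mul_of_nonneg_right ((le_abs_self _).trans (mul_abs_bd tx ty))
        (sub_nonneg.2 (same (mul_pos_of_neg_of_neg hx hy)))
    · rw [sg_of_tau_zero hy]; simp
    · have ty := neg g0 g1 y hy
      refine mul_le_mul_of_nonpos_right ?_ (sub_nonpos.2 (opp (mul_neg_of_neg_of_pos hx hy)))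
      have := (neg_abs_le _).trans' (neg_le_neg (mul_abs_bd tx ty)); linarith
  · have : ‖x - sg v y‖ = ‖x - y‖ := by
      rw [← sq_eq_sq₀ (norm_nonneg _) (norm_nonneg _), hn, hx]; ring
    rw [this]; simp
  · have tx := neg f0 f1 x hx
    rcases lt_trichotomy (tau v y) 0 with hy | hy | hy
    · have ty := T_diff hv g0 g1 y hy
      refine mul_le_mul_of_nonpos_right ?_ (sub_nonpos.2 (opp (mul_neg_of_pos_of_neg hx hy)))
      have := (neg_abs_le _).trans' (neg_le_neg (mul_abs_bd tx ty)); linarith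
    · rw [sg_of_tau_zero hy]; simp
    · have ty := neg g0 g1 y hy
      refine mul_le_mul_of_nonneg_right ?_ (sub_nonneg.2 (same (mul_pos hx hy)))
      have := ((le_abs_self _).trans (mul_abs_bd tx ty)); linarith

lemma J_meas {k : ℝ → ℝ} (hk : Antitone k) {f g : EuclideanSpace ℝ (Fin n) → ℝ}
    (hf : Measurable f) (hg : Measurable g) :
    Measurable (fun p : EuclideanSpace ℝ (Fin n) × EuclideanSpace ℝ (Fin n) =>
      ENNReal.ofReal (f p.1 * g p.2 * k ‖p.1 - p.2‖)) := by
  have := hk.measurable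
  fun_prop

lemma J_four {k : ℝ → ℝ} (hk : Antitone k) (hk0 : ∀ s, 0 ≤ k s)
    {v : EuclideanSpace ℝ (Fin n)} (hv : v ≠ 0) {f g : EuclideanSpace ℝ (Fin n) → ℝ}
    (hf : Measurable f) (hg : Measurable g) (f0 : ∀ x, 0 ≤ f x) (g0 : ∀ x, 0 ≤ g x) :
    4 * J k f g = ∫⁻ p : EuclideanSpace ℝ (Fin n) × EuclideanSpace ℝ (Fin n), ENNReal.ofReal
      (f p.1 * g p.2 * k ‖p.1 - p.2‖ + f (sg v p.1) * g (sg v p.2) * k ‖p.1 - p.2‖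
       + f p.1 * g (sg v p.2) * k ‖p.1 - sg v p.2‖ + f (sg v p.1) * g p.2 * k ‖p.1 - sg v p.2‖)
      ∂(volume.prod volume) := by
  have hF := J_meas (n := n) hk hf hg
  have m1 := (mp_sg v).prod (mp_sg v)
  have m2 := (MeasurePreserving.id (volume : Measure (EuclideanSpace ℝ (Fin n)))).prod (mp_sg v)
  have m3 := (mp_sg v).prod (MeasurePreserving.id (volume : Measure (EuclideanSpace ℝ (Fin n))))
  have e1 := m1.lintegral_comp hF
  have e2 := m2.lintegral_comp hF
  have e3 := m3.lintegral_comp hF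
  have h1 := hF.comp m1.measurable
  have h2 := hF.comp m2.measurable
  have h3 := hF.comp m3.measurable
  have fold : ∀ x y : EuclideanSpace ℝ (Fin n), ‖sg v x - y‖ = ‖x - sg v y‖ := by
    intro x y
    conv_lhs => rw [← sg_sg hv y]
    exact norm_sg_sub_sg _ _ _
  simp only [Function.comp_def, Prod.map, id, fold, sg_sg hv] at e1 e2 e3 h1 h2 h3
  have : ∀ p : EuclideanSpace ℝ (Fin n) × EuclideanSpace ℝ (Fin n), ENNReal.ofReal
      (f p.1 * g p.2 * k ‖p.1 - p.2‖ + f (sg v p.1) * g (sg v p.2) * k ‖p.1 - p.2‖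
       + f p.1 * g (sg v p.2) * k ‖p.1 - sg v p.2‖ + f (sg v p.1) * g p.2 * k ‖p.1 - sg v p.2‖)
      = ENNReal.ofReal (f p.1 * g p.2 * k ‖p.1 - p.2‖)
       + ENNReal.ofReal (f (sg v p.1) * g (sg v p.2) * k ‖p.1 - p.2‖)
       + ENNReal.ofReal (f p.1 * g (sg v p.2) * k ‖p.1 - sg v p.2‖)
       + ENNReal.ofReal (f (sg v p.1) * g p.2 * k ‖p.1 - sg v p.2‖) := by
    intro p
    have q1 : ∀ x y s, 0 ≤ f x * g y * k s := fun x y s =>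
      mul_nonneg (mul_nonneg (f0 x) (g0 y)) (hk0 s)
    rw [ENNReal.ofReal_add (add_nonneg (add_nonneg (q1 _ _ _) (q1 _ _ _)) (q1 _ _ _)) (q1 _ _ _),
      ENNReal.ofReal_add (add_nonneg (q1 _ _ _) (q1 _ _ _)) (q1 _ _ _),
      ENNReal.ofReal_add (q1 _ _ _) (q1 _ _ _)]
  simp_rw [this]
  rw [lintegral_add_right _ h3, lintegral_add_right _ h2, lintegral_add_right _ h1, e1, e2, e3]
  unfold J; ring

lemma J_T {k : ℝ → ℝ} (hk : Antitone k) (hk0 : ∀ s, 0 ≤ k s)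
    {v : EuclideanSpace ℝ (Fin n)} (hv : v ≠ 0) {f g : EuclideanSpace ℝ (Fin n) → ℝ}
    (hf : Measurable f) (hg : Measurable g)
    (f0 : ∀ x, 0 ≤ f x) (f1 : ∀ x, f x ≤ 1) (g0 : ∀ x, 0 ≤ g x) (g1 : ∀ x, g x ≤ 1) :
    J k f g ≤ J k (T v f) (T v g) := by
  have : 4 * J k f g ≤ 4 * J k (T v f) (T v g) := by
    rw [J_four hk hk0 hv hf hg f0 g0, J_four hk hk0 hv (T_meas hf v) (T_meas hg v)
      (T_nonneg f0 v) (T_nonneg g0 v)]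
    refine lintegral_mono fun p => ENNReal.ofReal_le_ofReal ?_
    exact four_sum (T_sum hv f _) (T_sum hv g _) (key_pt hk hv f0 f1 g0 g1 p.1 p.2)
  exact (ENNReal.mul_le_mul_iff_right (by norm_num) (by norm_num)).1 this


lemma fold2 (v : EuclideanSpace ℝ (Fin n)) {F : EuclideanSpace ℝ (Fin n) → ℝ}
    (hF : Measurable F) (h0 : ∀ x, 0 ≤ F x) :
    2 * ∫⁻ x, ENNReal.ofReal (F x) = ∫⁻ x, ENNReal.ofReal (F x + F (sg v x)) := by
  simp_rw [ENNReal.ofReal_add (h0 _) (h0 _)]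
  rw [lintegral_add_left hF.ennreal_ofReal, (mp_sg v).lintegral_comp hF.ennreal_ofReal, two_mul]

lemma two_mul_cancel {a b : ENNReal} (h : 2 * a ≤ 2 * b) : a ≤ b :=
  (ENNReal.mul_le_mul_iff_right (by norm_num) (by norm_num)).1 h

lemma tau_neg_of_norm_lt {v x : EuclideanSpace ℝ (Fin n)} (hv : v ≠ 0) (h : ‖x‖ < ‖sg v x‖) :
    tau v x < 0 := by
  have h1 := norm_sg_sq hv x
  have hv2 : 0 < ‖v‖ ^ 2 := by positivity
  have : ‖x‖ ^ 2 < ‖sg v x‖ ^ 2 := pow_lt_pow_left₀ h (norm_nonneg _) (by norm_num)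
  by_contra hc
  push Not at hc
  nlinarith [mul_nonneg hc hv2.le]

lemma norm_le_of_tau_neg {v x : EuclideanSpace ℝ (Fin n)} (hv : v ≠ 0) (h : tau v x < 0) :
    ‖x‖ ≤ ‖sg v x‖ := by
  have h1 := norm_sg_sq hv x
  have hv2 : 0 < ‖v‖ ^ 2 := by positivity
  apply le_of_sq_le_sq _ (norm_nonneg _)
  nlinarith [mul_pos (neg_pos.2 h) hv2]

lemma T_adm {R m : ℝ} {f : EuclideanSpace ℝ (Fin n) → ℝ} (hf : Adm R m f)
    {v : EuclideanSpace ℝ (Fin n)} (hv : v ≠ 0) : Adm R m (T v f) where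
  meas := T_meas hf.meas v
  nonneg := T_nonneg hf.nonneg v
  le_one := T_le_one hf.le_one v
  supp := by
    intro x hx
    have e := hf.supp x hx
    unfold T
    split_ifs with h1 h2
    · rw [e, hf.supp _ (hx.trans (norm_le_of_tau_neg hv h1))]; simp
    · exact e
    · rw [e]; have := hf.le_one (sg v x); exact max_eq_right (by linarith)
  mass := by
    refine (two_mul_cancel ?_).trans hf.mass
    rw [fold2 v (T_meas hf.meas v) (T_nonneg hf.nonneg v), fold2 v hf.meas hf.nonneg]
    simp_rw [T_sum hv]; exact le_rfl

/-- part of `f` outside the ball -/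
noncomputable def q (r : ℝ) (f : EuclideanSpace ℝ (Fin n) → ℝ) (x : EuclideanSpace ℝ (Fin n)) : ℝ :=
  if ‖x‖ < r then 0 else f x

/-- defect of `f` inside the ball -/
noncomputable def P (r : ℝ) (f : EuclideanSpace ℝ (Fin n) → ℝ) (x : EuclideanSpace ℝ (Fin n)) : ℝ :=
  if ‖x‖ < r then 1 - f x else 0

/-- mass outside the ball -/
noncomputable def delta (r : ℝ) (f : EuclideanSpace ℝ (Fin n) → ℝ) : ENNReal :=
  ∫⁻ x, ENNReal.ofReal (q r f x)

/-- the gain -/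
noncomputable def G (r : ℝ) (f : EuclideanSpace ℝ (Fin n) → ℝ)
    (v : EuclideanSpace ℝ (Fin n)) : ENNReal :=
  ∫⁻ x, ENNReal.ofReal (P r f x * q r f (sg v x))

lemma q_meas {r : ℝ} {f : EuclideanSpace ℝ (Fin n) → ℝ} (hf : Measurable f) :
    Measurable (q r f) :=
  Measurable.ite (measurableSet_lt measurable_norm measurable_const) measurable_const hf

lemma P_meas {r : ℝ} {f : EuclideanSpace ℝ (Fin n) → ℝ} (hf : Measurable f) :
    Measurable (P r f) :=
  Measurable.ite (measurableSet_lt measurable_norm measurable_const) (hf.const_sub 1)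
    measurable_const

lemma q_nonneg {r : ℝ} {f : EuclideanSpace ℝ (Fin n) → ℝ} (hf : ∀ x, 0 ≤ f x)
    (x : EuclideanSpace ℝ (Fin n)) : 0 ≤ q r f x := by
  unfold q; split_ifs; exacts [le_rfl, hf x]

lemma P_nonneg {r : ℝ} {f : EuclideanSpace ℝ (Fin n) → ℝ} (hf : ∀ x, f x ≤ 1)
    (x : EuclideanSpace ℝ (Fin n)) : 0 ≤ P r f x := by
  unfold P; split_ifs; exacts [sub_nonneg.2 (hf x), le_rfl]

lemma gain {R m r : ℝ} {f : EuclideanSpace ℝ (Fin n) → ℝ} (hf : Adm R m f)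
    {v : EuclideanSpace ℝ (Fin n)} (hv : v ≠ 0) :
    delta r (T v f) + G r f v ≤ delta r f := by
  have hT := T_adm hf hv
  have mG : Measurable (fun x => P r f x * q r f (sg v x)) :=
    (P_meas hf.meas).mul ((q_meas hf.meas).comp (mp_sg v).measurable)
  have nG : ∀ x, 0 ≤ P r f x * q r f (sg v x) :=
    fun x => mul_nonneg (P_nonneg hf.le_one x) (q_nonneg hf.nonneg _)
  apply two_mul_cancel
  unfold delta G
  rw [mul_add, fold2 v (q_meas hT.meas) (q_nonneg hT.nonneg),
    fold2 v (q_meas hf.meas) (q_nonneg hf.nonneg), fold2 v mG nG, ← lintegral_add_left]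
  swap
  · exact ((q_meas hT.meas).add ((q_meas hT.meas).comp (mp_sg v).measurable)).ennreal_ofReal
  refine lintegral_mono fun x => ?_
  simp only
  rw [← ENNReal.ofReal_add (add_nonneg (q_nonneg hT.nonneg _) (q_nonneg hT.nonneg _))
    (add_nonneg (nG _) (nG _)), sg_sg hv]
  apply ENNReal.ofReal_le_ofReal
  have key : ∀ y, ‖y‖ < r → r ≤ ‖sg v y‖ →
      T v f (sg v y) + (1 - f y) * f (sg v y) ≤ f (sg v y) := by
    intro y h1 h2
    have ht := tau_neg_of_norm_lt hv (h1.trans_le h2)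
    have hs := T_sum hv f y
    have e : T v f y = min 1 (f y + f (sg v y)) := by rw [T, if_pos ht]
    have a0 := hf.nonneg y
    have a1 := hf.le_one y
    have b0 := hf.nonneg (sg v y)
    have b1 := hf.le_one (sg v y)
    have : f y + (1 - f y) * f (sg v y) ≤ T v f y := by
      rw [e]; apply le_min <;> nlinarith
    linarith
  by_cases h1 : ‖x‖ < r <;> by_cases h2 : ‖sg v x‖ < r
  · simp [q, P, h1, h2]
  · have := key x h1 (not_lt.1 h2)
    simpa [q, P, h1, h2] using this
  · have := key (sg v x) h2 (by rw [sg_sg hv]; exact not_lt.1 h1)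
    rw [sg_sg hv] at this
    simpa [q, P, h1, h2] using this
  · simpa [q, P, h1, h2] using (T_sum hv f x).le

lemma unit_lip {ε : ℝ} (hε : 0 < ε) {v w : EuclideanSpace ℝ (Fin n)} (hv : ε ≤ ‖v‖)
    (hw : ε ≤ ‖w‖) : ‖‖v‖⁻¹ • v - ‖w‖⁻¹ • w‖ ≤ 2 / ε * ‖v - w‖ := by
  have hv0 : 0 < ‖v‖ := hε.trans_le hv
  have hw0 : 0 < ‖w‖ := hε.trans_le hw
  have e : ‖v‖⁻¹ • v - ‖w‖⁻¹ • w = ‖v‖⁻¹ • (v - w) + (‖v‖⁻¹ - ‖w‖⁻¹) • w := by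
    rw [smul_sub, sub_smul]; abel
  have e2 : ‖v‖⁻¹ - ‖w‖⁻¹ = ‖v‖⁻¹ * ((‖w‖ - ‖v‖) * ‖w‖⁻¹) := by field_simp
  rw [e]
  refine (norm_add_le _ _).trans ?_
  rw [norm_smul, norm_smul, e2, norm_mul, norm_mul, Real.norm_eq_abs, Real.norm_eq_abs,
    Real.norm_eq_abs, abs_of_pos (inv_pos.2 hv0), abs_of_pos (inv_pos.2 hw0)]
  have h1 : |‖w‖ - ‖v‖| ≤ ‖v - w‖ := by rw [norm_sub_rev]; exact abs_norm_sub_norm_le _ _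
  have h2 : ‖v‖⁻¹ ≤ ε⁻¹ := inv_anti₀ hε hv
  have : ‖v‖⁻¹ * (|‖w‖ - ‖v‖| * ‖w‖⁻¹) * ‖w‖ = ‖v‖⁻¹ * |‖w‖ - ‖v‖| := by field_simp
  rw [this]
  calc _ ≤ ε⁻¹ * ‖v - w‖ + ε⁻¹ * ‖v - w‖ := by gcongr
    _ = _ := by ring

lemma sg_lip {R ε : ℝ} (hε : 0 < ε) {x v w : EuclideanSpace ℝ (Fin n)} (hx : ‖x‖ ≤ R)
    (hv : ε ≤ ‖v‖) (hw : ε ≤ ‖w‖) : ‖sg v x - sg w x‖ ≤ (1 + 8 * R / ε) * ‖v - w‖ := by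
  have hv0 : 0 < ‖v‖ := hε.trans_le hv
  have hw0 : 0 < ‖w‖ := hε.trans_le hw
  have hR : 0 ≤ R := (norm_nonneg _).trans hx
  have form : ∀ z : EuclideanSpace ℝ (Fin n), sg z x =
      x + z - (2 : ℝ) • (inner ℝ (‖z‖⁻¹ • z) x • (‖z‖⁻¹ • z)) := by
    intro z
    rw [sg, tau, sub_smul, one_smul, inner_smul_left, smul_smul, smul_smul]
    simp only [conj_trivial]
    have : 2 * (‖z‖⁻¹ * inner ℝ z x) * ‖z‖⁻¹ = 2 * inner ℝ z x / ‖z‖ ^ 2 := by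
      rw [div_eq_mul_inv, sq, mul_inv]; ring
    rw [this]; abel
  have ul := unit_lip hε hv hw
  rw [form v, form w]
  have nv : ‖‖v‖⁻¹ • v‖ = 1 := by rw [norm_smul, norm_inv, norm_norm]; field_simp
  have nw : ‖‖w‖⁻¹ • w‖ = 1 := by rw [norm_smul, norm_inv, norm_norm]; field_simp
  generalize ‖v‖⁻¹ • v = a at *
  generalize ‖w‖⁻¹ • w = b at *
  have e : x + v - (2 : ℝ) • (inner ℝ a x • a) - (x + w - (2 : ℝ) • (inner ℝ b x • b)) =
      (v - w) - (2 : ℝ) • (inner ℝ (a - b) x • a + inner ℝ b x • (a - b)) := by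
    rw [inner_sub_left]; module
  rw [e]
  have i1 : ‖inner ℝ (a - b) x • a‖ ≤ ‖a - b‖ * R := by
    rw [norm_smul, nv, mul_one]
    exact (norm_inner_le_norm _ _).trans (by gcongr)
  have i2 : ‖inner ℝ b x • (a - b)‖ ≤ R * ‖a - b‖ := by
    rw [norm_smul]
    gcongr
    refine (norm_inner_le_norm _ _).trans ?_
    rw [nw, one_mul]; exact hx
  have i3 : ‖(2 : ℝ) • (inner ℝ (a - b) x • a + inner ℝ b x • (a - b))‖ ≤ 4 * R * ‖a - b‖ := by
    rw [norm_smul]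
    have := norm_add_le (inner ℝ (a - b) x • a) (inner ℝ b x • (a - b))
    norm_num
    linarith
  have i4 : 4 * R * ‖a - b‖ ≤ 4 * R * (2 / ε * ‖v - w‖) := by gcongr
  calc _ ≤ ‖v - w‖ + 4 * R * (2 / ε * ‖v - w‖) := (norm_sub_le _ _).trans (by linarith)
    _ = _ := by ring

lemma vol_image_le {K : NNReal} {φ : EuclideanSpace ℝ (Fin n) → EuclideanSpace ℝ (Fin n)}
    {s : Set (EuclideanSpace ℝ (Fin n))} (h : LipschitzOnWith K φ s) :
    volume (φ '' s) ≤ (K : ENNReal) ^ (n : ℝ) * volume s := by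
  have h1 := h.hausdorffMeasure_image_le (d := (n : ℝ)) (by positivity)
  have : Measure.IsAddHaarMeasure
      (Measure.hausdorffMeasure (n : ℝ) : Measure (EuclideanSpace ℝ (Fin n))) := by
    simpa using MeasureTheory.isAddHaarMeasure_hausdorffMeasure (E := EuclideanSpace ℝ (Fin n))
  have h2 := Measure.isAddLeftInvariant_eq_smul (volume : Measure (EuclideanSpace ℝ (Fin n)))
    (Measure.hausdorffMeasure (n : ℝ))
  rw [h2]
  simp only [Measure.smul_apply, ENNReal.smul_def, smul_eq_mul]
  calc _ ≤ _ := mul_le_mul_right h1 _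
    _ = _ := by ring

lemma sg_surj {r r' R : ℝ} (hr' : r' < r) (hrR : r ≤ R) (h0 : 0 ≤ r')
    {x y : EuclideanSpace ℝ (Fin n)}
    (hx : ‖x‖ ≤ r') (hy : r ≤ ‖y‖) (hy' : ‖y‖ < R) :
    ∃ v, (r ^ 2 - r' ^ 2) / (2 * R) ≤ ‖v‖ ∧ ‖v‖ ≤ 2 * R ∧ sg v x = y := by
  have hxy : ‖x‖ < ‖y‖ := by linarith
  have hne : y - x ≠ 0 := by
    intro h; rw [sub_eq_zero] at h; rw [h] at hxy; exact lt_irrefl _ hxy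
  have hd : 0 < ‖y - x‖ := norm_pos_iff.2 hne
  have hx0 := norm_nonneg x
  have hsq : 0 < ‖y‖ ^ 2 - ‖x‖ ^ 2 := by nlinarith
  have nv : ‖((‖y‖ ^ 2 - ‖x‖ ^ 2) / ‖y - x‖ ^ 2) • (y - x)‖
      = (‖y‖ ^ 2 - ‖x‖ ^ 2) / ‖y - x‖ := by
    rw [norm_smul, Real.norm_eq_abs, abs_of_pos (by positivity)]; field_simp
  have t1 : ‖y - x‖ ≤ ‖y‖ + ‖x‖ := norm_sub_le _ _
  have t2 : ‖y‖ - ‖x‖ ≤ ‖y - x‖ := norm_sub_norm_le _ _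
  refine ⟨((‖y‖ ^ 2 - ‖x‖ ^ 2) / ‖y - x‖ ^ 2) • (y - x), ?_, ?_, ?_⟩
  · rw [nv]
    apply div_le_div₀ hsq.le _ hd (by linarith)
    nlinarith
  · rw [nv, div_le_iff₀ hd]; nlinarith
  · have e1 : ‖y - x‖ ^ 2 = ‖y‖ ^ 2 - 2 * inner ℝ y x + ‖x‖ ^ 2 := norm_sub_sq_real y x
    have e2 : tau (((‖y‖ ^ 2 - ‖x‖ ^ 2) / ‖y - x‖ ^ 2) • (y - x)) x
        = - (‖y - x‖ ^ 2 / (‖y‖ ^ 2 - ‖x‖ ^ 2)) := by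
      rw [tau, nv, inner_smul_left, inner_sub_left, real_inner_self_eq_norm_sq]
      simp only [conj_trivial]
      have e3 : inner ℝ y x = (‖y‖ ^ 2 + ‖x‖ ^ 2 - ‖y - x‖ ^ 2) / 2 := by linarith
      rw [e3]
      field_simp
      ring
    rw [sg, e2, neg_smul, smul_smul]
    have : ‖y - x‖ ^ 2 / (‖y‖ ^ 2 - ‖x‖ ^ 2) * ((‖y‖ ^ 2 - ‖x‖ ^ 2) / ‖y - x‖ ^ 2) = 1 := by
      field_simp
    rw [this]; simp


lemma meas_sg_left (x : EuclideanSpace ℝ (Fin n)) : Measurable (fun v => sg v x) :=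
  (meas_sg (n := n)).comp (measurable_id.prodMk measurable_const)

lemma avg {r r' R : ℝ} (hr' : r' < r) (hrR : r ≤ R) (h0 : 0 ≤ r') :
    ∃ C : ENNReal, C ≠ ⊤ ∧ ∀ x : EuclideanSpace ℝ (Fin n), ‖x‖ ≤ r' →
      ∀ Q : EuclideanSpace ℝ (Fin n) → ENNReal, Measurable Q →
      (∀ y, ‖y‖ < r → Q y = 0) → (∀ y, R ≤ ‖y‖ → Q y = 0) →
      ∫⁻ y, Q y ≤ C * ∫⁻ v in {v | (r ^ 2 - r' ^ 2) / (2 * R) ≤ ‖v‖ ∧ ‖v‖ ≤ 2 * R},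
        Q (sg v x) := by
  set ε := (r ^ 2 - r' ^ 2) / (2 * R) with hε
  have hε0 : 0 < ε := by apply div_pos <;> nlinarith
  set W : Set (EuclideanSpace ℝ (Fin n)) := {v | ε ≤ ‖v‖ ∧ ‖v‖ ≤ 2 * R} with hW
  set S : Set (EuclideanSpace ℝ (Fin n)) := {y | r ≤ ‖y‖ ∧ ‖y‖ < R} with hS
  have hWm : MeasurableSet W := (measurableSet_le measurable_const measurable_norm).inter
    (measurableSet_le measurable_norm measurable_const)
  have hSm : MeasurableSet S := (measurableSet_le measurable_const measurable_norm).inter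
    (measurableSet_lt measurable_norm measurable_const)
  refine ⟨((1 + 8 * R / ε).toNNReal : ENNReal) ^ (n : ℝ),
    ENNReal.rpow_ne_top_of_nonneg (by positivity) ENNReal.coe_ne_top, ?_⟩
  intro x hx Q hQ hQ1 hQ2
  set C := ((1 + 8 * R / ε).toNNReal : ENNReal) ^ (n : ℝ)
  have hφ : Measurable (fun v => sg v x) :=
    (meas_sg (n := n)).comp (measurable_id.prodMk measurable_const)
  have hle : volume.restrict S ≤ C • (volume.restrict W).map (fun v => sg v x) := by
    refine Measure.le_iff.2 fun A hA => ?_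
    rw [Measure.restrict_apply hA, Measure.smul_apply, Measure.map_apply hφ hA,
      Measure.restrict_apply (hφ hA), smul_eq_mul]
    have hl : LipschitzOnWith (1 + 8 * R / ε).toNNReal (fun v => sg v x)
        ((fun v => sg v x) ⁻¹' A ∩ W) := by
      refine LipschitzOnWith.of_dist_le_mul fun v hv w hw => ?_
      rw [dist_eq_norm, dist_eq_norm, Real.coe_toNNReal _ (by
        have : 0 ≤ R := by linarith
        positivity)]
      exact sg_lip hε0 (hx.trans (by linarith)) hv.2.1 hw.2.1
    refine (measure_mono ?_).trans (vol_image_le hl)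
    rintro y ⟨hyA, hy1, hy2⟩
    obtain ⟨v, h1, h2, h3⟩ := sg_surj hr' hrR h0 hx hy1 hy2
    exact ⟨v, ⟨by simpa [h3] using hyA, h1, h2⟩, h3⟩
  calc ∫⁻ y, Q y = ∫⁻ y in S, Q y := by
        rw [← lintegral_indicator hSm]
        congr 1; ext y
        by_cases hy : y ∈ S
        · simp [hy]
        · rw [Set.indicator_of_notMem hy]
          by_cases h1 : ‖y‖ < r
          · exact hQ1 y h1
          · by_cases h2 : R ≤ ‖y‖
            · exact hQ2 y h2
            · exact absurd ⟨not_lt.1 h1, not_le.1 h2⟩ hy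
    _ ≤ ∫⁻ y, Q y ∂(C • (volume.restrict W).map (fun v => sg v x)) := lintegral_mono' hle le_rfl
    _ = _ := by rw [lintegral_smul_measure, lintegral_map hQ hφ, smul_eq_mul]

lemma exists_inner {r : ℝ} (hr : 0 < r) {e : ENNReal} (he : e ≠ 0) :
    ∃ r', 0 < r' ∧ r' < r ∧ volume (Metric.ball (0 : EuclideanSpace ℝ (Fin n)) r) ≤
      volume (Metric.ball (0 : EuclideanSpace ℝ (Fin n)) r') + e := by
  set V := volume (Metric.ball (0 : EuclideanSpace ℝ (Fin n)) 1)
  have hV : V ≠ ⊤ := measure_ball_lt_top.ne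
  have form : ∀ s : ℝ, 0 < s → volume (Metric.ball (0 : EuclideanSpace ℝ (Fin n)) s) =
      ENNReal.ofReal (s ^ n) * V := by
    intro s hs
    rw [Measure.addHaar_ball_of_pos _ _ hs]; simp [V]
  have hc : Continuous (fun s : ℝ => ENNReal.ofReal (s ^ n) * V + e) := by
    refine Continuous.add ?_ continuous_const
    exact (ENNReal.continuous_mul_const hV).comp
      (ENNReal.continuous_ofReal.comp (continuous_pow n))
  have hlt : ENNReal.ofReal (r ^ n) * V < ENNReal.ofReal (r ^ n) * V + e :=
    ENNReal.lt_add_right (ENNReal.mul_ne_top ENNReal.ofReal_ne_top hV) he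
  have ev : ∀ᶠ s in nhds r, ENNReal.ofReal (r ^ n) * V < ENNReal.ofReal (s ^ n) * V + e :=
    hc.continuousAt.eventually (lt_mem_nhds hlt)
  have ev2 : ∀ᶠ s in nhdsWithin r (Set.Iio r), 0 < s ∧ s < r ∧
      ENNReal.ofReal (r ^ n) * V < ENNReal.ofReal (s ^ n) * V + e := by
    filter_upwards [nhdsWithin_le_nhds ev, self_mem_nhdsWithin,
      nhdsWithin_le_nhds (lt_mem_nhds hr)] with s h1 h2 h3
    exact ⟨h3, h2, h1⟩
  obtain ⟨s, h1, h2, h3⟩ := ev2.exists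
  refine ⟨s, h1, h2, ?_⟩
  rw [form r hr, form s h1]; exact h3.le

lemma delta_le_P {R r : ℝ} {f : EuclideanSpace ℝ (Fin n) → ℝ} (hf : Adm R r f) :
    delta r f ≤ ∫⁻ x, ENNReal.ofReal (P r f x) := by
  set B := Metric.ball (0 : EuclideanSpace ℝ (Fin n)) r
  have hB : MeasurableSet B := measurableSet_ball
  have memB : ∀ x, x ∈ B ↔ ‖x‖ < r := fun x => mem_ball_zero_iff
  set I := ∫⁻ x in B, ENNReal.ofReal (f x)
  have hI : I ≠ ⊤ := by
    refine ne_top_of_le_ne_top (measure_ball_lt_top (μ := volume)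
      (x := (0 : EuclideanSpace ℝ (Fin n))) (r := r)).ne ?_
    exact (setLIntegral_le_lintegral _ _).trans hf.mass
  have h1 : I + delta r f = ∫⁻ x, ENNReal.ofReal (f x) := by
    rw [← lintegral_add_compl _ hB]
    congr 1
    rw [delta, ← lintegral_indicator hB.compl]
    congr 1; ext x
    by_cases hx : x ∈ B
    · simp [q, (memB x).1 hx, hx]
    · have := mt (memB x).2 hx
      simp [q, hx, this]
  have h2 : volume B = I + ∫⁻ x, ENNReal.ofReal (P r f x) := by
    have : ∫⁻ x, ENNReal.ofReal (P r f x) = ∫⁻ x in B, ENNReal.ofReal (1 - f x) := by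
      rw [← lintegral_indicator hB]
      congr 1; ext x
      by_cases hx : x ∈ B
      · simp [P, (memB x).1 hx, hx]
      · have := mt (memB x).2 hx
        simp [P, hx, this]
    rw [this, ← lintegral_add_left hf.meas.ennreal_ofReal]
    have : ∀ x, ENNReal.ofReal (f x) + ENNReal.ofReal (1 - f x) = 1 := by
      intro x
      rw [← ENNReal.ofReal_add (hf.nonneg x) (sub_nonneg.2 (hf.le_one x))]; simp
    simp [this]
  have := hf.mass
  rw [← h1, h2] at this
  exact (ENNReal.add_le_add_iff_left hI).1 this

lemma uniform_gain {r R : ℝ} (hr : 0 < r) (hrR : r ≤ R) {d : ENNReal} (hd : d ≠ 0) :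
    ∃ γ : ENNReal, γ ≠ 0 ∧ ∀ f : EuclideanSpace ℝ (Fin n) → ℝ, Adm R r f → d ≤ delta r f →
      ∃ v, v ≠ 0 ∧ γ ≤ G r f v := by
  have hd2 : d / 2 ≠ 0 := by simp [hd]
  obtain ⟨r', h0, hr', hvol⟩ := exists_inner (n := n) hr hd2
  obtain ⟨C, hC, havg⟩ := avg (n := n) hr' hrR h0.le
  set W : Set (EuclideanSpace ℝ (Fin n)) :=
    {v | (r ^ 2 - r' ^ 2) / (2 * R) ≤ ‖v‖ ∧ ‖v‖ ≤ 2 * R} with hW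
  have hWm : MeasurableSet W := (measurableSet_le measurable_const measurable_norm).inter
    (measurableSet_le measurable_norm measurable_const)
  have hWfin : volume W ≠ ⊤ := by
    refine ne_top_of_le_ne_top (measure_closedBall_lt_top (μ := volume)
      (x := (0 : EuclideanSpace ℝ (Fin n))) (r := 2 * R)).ne (measure_mono ?_)
    intro v hv; simpa using hv.2
  obtain ⟨γ, hγ, hγ2⟩ := ENNReal.exists_nnreal_pos_mul_lt (a := C * volume W) (b := d * (d / 2))
    (ENNReal.mul_ne_top hC hWfin) (mul_ne_zero hd hd2)
  refine ⟨γ, by exact_mod_cast hγ.ne', ?_⟩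
  intro f hf hdf
  by_contra hcon
  push Not at hcon
  have hGle : ∀ v ∈ W, G r f v ≤ γ := by
    intro v hv
    refine (hcon v ?_).le
    rintro rfl
    have : 0 < (r ^ 2 - r' ^ 2) / (2 * R) := by apply div_pos <;> nlinarith
    have := hv.1
    simp at this
    linarith
  have hGW : ∫⁻ v in W, G r f v ≤ γ * volume W := by
    calc _ ≤ ∫⁻ v in W, (γ : ENNReal) := setLIntegral_mono' hWm hGle
      _ = _ := by simp
  have hPd := delta_le_P hf
  have hdfin : d ≠ ⊤ := by
    refine ne_top_of_le_ne_top (measure_ball_lt_top (μ := volume)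
      (x := (0 : EuclideanSpace ℝ (Fin n))) (r := r)).ne (hdf.trans (le_trans ?_ hf.mass))
    refine lintegral_mono fun x => ENNReal.ofReal_le_ofReal ?_
    unfold q; split_ifs; exacts [hf.nonneg x, le_rfl]
  -- defect in the inner ball
  set B' := Metric.ball (0 : EuclideanSpace ℝ (Fin n)) r'
  have hB' : MeasurableSet B' := measurableSet_ball
  set A := ∫⁻ x in B', ENNReal.ofReal (P r f x)
  have hA : d / 2 ≤ A := by
    have h1 : ∫⁻ x, ENNReal.ofReal (P r f x) ≤ A + d / 2 := by
      rw [← lintegral_add_compl _ hB']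
      gcongr
      have h2 : ∫⁻ x in B'ᶜ, ENNReal.ofReal (P r f x) ≤
          volume (Metric.ball (0 : EuclideanSpace ℝ (Fin n)) r \ B') := by
        rw [← lintegral_indicator hB'.compl, ← lintegral_indicator_one (measurableSet_ball.diff hB')]
        refine lintegral_mono fun x => ?_
        by_cases hx : x ∈ B'
        · simp [hx]
        · by_cases hx2 : ‖x‖ < r
          · have hm : x ∈ Metric.ball (0 : EuclideanSpace ℝ (Fin n)) r \ B' :=
              ⟨mem_ball_zero_iff.2 hx2, hx⟩
            rw [Set.indicator_of_mem hm]
            simp only [Set.indicator, Set.mem_compl_iff, hx, not_false_eq_true, if_true, P, hx2,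
              Pi.one_apply]
            rw [ENNReal.ofReal_le_one]; have := hf.nonneg x; linarith
          · simp [P, hx2, hx]
      refine h2.trans ?_
      rw [measure_sdiff (Metric.ball_subset_ball hr'.le) hB'.nullMeasurableSet
        measure_ball_lt_top.ne]
      exact tsub_le_iff_left.2 hvol
    have h3 : d / 2 + d / 2 ≤ A + d / 2 := by
      rw [ENNReal.add_halves]; exact (hdf.trans hPd).trans h1
    exact (ENNReal.add_le_add_iff_right (ENNReal.div_ne_top hdfin (by norm_num))).1 h3
  have mq : Measurable (fun p : EuclideanSpace ℝ (Fin n) × EuclideanSpace ℝ (Fin n) =>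
      ENNReal.ofReal (q r f (sg p.1 p.2))) :=
    ((q_meas hf.meas).comp meas_sg).ennreal_ofReal
  have hswap : ∫⁻ v in W, G r f v = ∫⁻ x, ENNReal.ofReal (P r f x) *
      ∫⁻ v in W, ENNReal.ofReal (q r f (sg v x)) := by
    unfold G
    simp_rw [ENNReal.ofReal_mul (P_nonneg hf.le_one _)]
    rw [lintegral_lintegral_swap]
    · congr 1; ext x
      rw [lintegral_const_mul]
      exact ((q_meas hf.meas).comp (meas_sg_left x)).ennreal_ofReal
    · refine Measurable.aemeasurable ?_
      exact ((P_meas hf.meas).ennreal_ofReal.comp measurable_snd).mul mq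
  have hfinal : d * (d / 2) ≤ C * ∫⁻ v in W, G r f v := by
    calc d * (d / 2) ≤ delta r f * A := by gcongr
      _ = ∫⁻ x in B', ENNReal.ofReal (P r f x) * delta r f := by
          rw [lintegral_mul_const _ (P_meas hf.meas).ennreal_ofReal, mul_comm]
      _ ≤ ∫⁻ x in B', C * (ENNReal.ofReal (P r f x) *
            ∫⁻ v in W, ENNReal.ofReal (q r f (sg v x))) := by
          refine setLIntegral_mono' hB' fun x hx => ?_
          have h1 := havg x (mem_ball_zero_iff.1 hx).le (fun y => ENNReal.ofReal (q r f y))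
            (q_meas hf.meas).ennreal_ofReal (fun y hy => by simp [q, hy])
            (fun y hy => by simp [q, hf.supp y hy])
          calc _ ≤ ENNReal.ofReal (P r f x) * (C * ∫⁻ v in W, ENNReal.ofReal (q r f (sg v x))) := by
                gcongr; exact h1
            _ = _ := by ring
      _ ≤ ∫⁻ x, C * (ENNReal.ofReal (P r f x) *
            ∫⁻ v in W, ENNReal.ofReal (q r f (sg v x))) := setLIntegral_le_lintegral _ _
      _ = _ := by rw [lintegral_const_mul' _ _ hC, hswap]
  have : d * (d / 2) ≤ γ * (C * volume W) := by
    refine hfinal.trans ?_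
    calc _ ≤ C * (γ * volume W) := by gcongr
      _ = _ := by ring
  exact absurd hγ2 (not_lt.2 this)


/-- indicator of the ball -/
noncomputable def ib (n : ℕ) (r : ℝ) : EuclideanSpace ℝ (Fin n) → ℝ :=
  (Metric.ball (0 : EuclideanSpace ℝ (Fin n)) r).indicator (fun _ => (1:ℝ))

lemma ib_meas (r : ℝ) : Measurable (ib n r) := measurable_const.indicator measurableSet_ball

lemma ib_nonneg (r : ℝ) (x : EuclideanSpace ℝ (Fin n)) : 0 ≤ ib n r x :=
  Set.indicator_nonneg (fun _ _ => zero_le_one) x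

lemma le_ib_add_q (r : ℝ) {f : EuclideanSpace ℝ (Fin n) → ℝ} (f1 : ∀ x, f x ≤ 1)
    (x : EuclideanSpace ℝ (Fin n)) : f x ≤ ib n r x + q r f x := by
  by_cases hx : ‖x‖ < r
  · have : x ∈ Metric.ball (0 : EuclideanSpace ℝ (Fin n)) r := mem_ball_zero_iff.2 hx
    simpa [ib, q, hx] using f1 x
  · simp [ib, q, hx]

lemma J_prod {f g : EuclideanSpace ℝ (Fin n) → ℝ} (hf : Measurable f) (hg : Measurable g)
    (f0 : ∀ x, 0 ≤ f x) :
    ∫⁻ p : EuclideanSpace ℝ (Fin n) × EuclideanSpace ℝ (Fin n),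
      ENNReal.ofReal (f p.1 * g p.2) ∂(volume.prod volume)
    = (∫⁻ x, ENNReal.ofReal (f x)) * ∫⁻ x, ENNReal.ofReal (g x) := by
  simp_rw [ENNReal.ofReal_mul (f0 _)]
  exact lintegral_prod_mul hf.ennreal_ofReal.aemeasurable hg.ennreal_ofReal.aemeasurable

lemma ib_mass (r : ℝ) : ∫⁻ x, ENNReal.ofReal (ib n r x) =
    volume (Metric.ball (0 : EuclideanSpace ℝ (Fin n)) r) := by
  rw [← lintegral_indicator_one measurableSet_ball]
  congr 1; ext x
  by_cases hx : x ∈ Metric.ball (0 : EuclideanSpace ℝ (Fin n)) r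
  · rw [Set.indicator_of_mem hx, ib, Set.indicator_of_mem hx]; simp
  · rw [Set.indicator_of_notMem hx, ib, Set.indicator_of_notMem hx]; simp

lemma J_err {k : ℝ → ℝ} (hk : Antitone k) (hk0 : ∀ s, 0 ≤ k s) {R r₁ r₂ : ℝ}
    {f g : EuclideanSpace ℝ (Fin n) → ℝ} (hf : Adm R r₁ f) (hg : Adm R r₂ g) :
    J k f g ≤ J k (ib n r₁) (ib n r₂) + ENNReal.ofReal (k 0) *
      (volume (Metric.ball (0 : EuclideanSpace ℝ (Fin n)) r₂) +
       volume (Metric.ball (0 : EuclideanSpace ℝ (Fin n)) r₁)) * (delta r₁ f + delta r₂ g) := by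
  have hpt : ∀ p : EuclideanSpace ℝ (Fin n) × EuclideanSpace ℝ (Fin n),
      ENNReal.ofReal (f p.1 * g p.2 * k ‖p.1 - p.2‖) ≤
      ENNReal.ofReal (ib n r₁ p.1 * ib n r₂ p.2 * k ‖p.1 - p.2‖) +
      (ENNReal.ofReal (k 0) * ENNReal.ofReal (q r₁ f p.1 * g p.2) +
       ENNReal.ofReal (k 0) * ENNReal.ofReal (ib n r₁ p.1 * q r₂ g p.2)) := by
    intro p
    have f0 := hf.nonneg p.1
    have g0 := hg.nonneg p.2
    have q1 : 0 ≤ q r₁ f p.1 := q_nonneg hf.nonneg _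
    have q2 : 0 ≤ q r₂ g p.2 := q_nonneg hg.nonneg _
    have i1 := ib_nonneg r₁ p.1
    have i2 := ib_nonneg r₂ p.2
    have k0 := hk0 0
    have kk := hk0 ‖p.1 - p.2‖
    have kle : k ‖p.1 - p.2‖ ≤ k 0 := hk (norm_nonneg _)
    have a1 := le_ib_add_q r₁ hf.le_one p.1
    have a2 := le_ib_add_q r₂ hg.le_one p.2
    rw [← ENNReal.ofReal_mul k0, ← ENNReal.ofReal_mul k0,
      ← ENNReal.ofReal_add (by positivity) (by positivity),
      ← ENNReal.ofReal_add (by positivity) (by positivity)]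
    apply ENNReal.ofReal_le_ofReal
    calc f p.1 * g p.2 * k ‖p.1 - p.2‖
        ≤ (ib n r₁ p.1 + q r₁ f p.1) * g p.2 * k ‖p.1 - p.2‖ := by gcongr
      _ = ib n r₁ p.1 * g p.2 * k ‖p.1 - p.2‖ + q r₁ f p.1 * g p.2 * k ‖p.1 - p.2‖ := by ring
      _ ≤ ib n r₁ p.1 * (ib n r₂ p.2 + q r₂ g p.2) * k ‖p.1 - p.2‖
          + q r₁ f p.1 * g p.2 * k ‖p.1 - p.2‖ := by gcongr
      _ = ib n r₁ p.1 * ib n r₂ p.2 * k ‖p.1 - p.2‖ + (q r₁ f p.1 * g p.2 * k ‖p.1 - p.2‖ +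
          ib n r₁ p.1 * q r₂ g p.2 * k ‖p.1 - p.2‖) := by ring
      _ ≤ ib n r₁ p.1 * ib n r₂ p.2 * k ‖p.1 - p.2‖ + (q r₁ f p.1 * g p.2 * k 0 +
          ib n r₁ p.1 * q r₂ g p.2 * k 0) := by gcongr
      _ = _ := by ring
  have m1 : Measurable (fun p : EuclideanSpace ℝ (Fin n) × EuclideanSpace ℝ (Fin n) =>
      ENNReal.ofReal (q r₁ f p.1 * g p.2)) :=
    (((q_meas hf.meas).comp measurable_fst).mul (hg.meas.comp measurable_snd)).ennreal_ofReal
  refine (lintegral_mono hpt).trans ?_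
  rw [lintegral_add_left (J_meas hk (ib_meas r₁) (ib_meas r₂)),
    lintegral_add_left (m1.const_mul _), lintegral_const_mul' _ _ ENNReal.ofReal_ne_top,
    lintegral_const_mul' _ _ ENNReal.ofReal_ne_top,
    J_prod (q_meas hf.meas) hg.meas (q_nonneg hf.nonneg),
    J_prod (ib_meas r₁) (q_meas hg.meas) (ib_nonneg r₁), ib_mass]
  unfold J
  gcongr
  have hgm := hg.mass
  change _ * (delta r₁ f * _) + _ * (_ * delta r₂ g) ≤ _
  rw [← mul_add, mul_assoc]
  gcongr
  rw [add_mul, mul_add, mul_add]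
  calc _ ≤ volume (Metric.ball (0 : EuclideanSpace ℝ (Fin n)) r₂) * delta r₁ f +
       volume (Metric.ball (0 : EuclideanSpace ℝ (Fin n)) r₁) * delta r₂ g := by
        rw [mul_comm (delta r₁ f)]; gcongr
    _ ≤ _ := add_le_add le_self_add le_add_self

lemma riesz_bdd {k : ℝ → ℝ} (hk : Antitone k) (hk0 : ∀ s, 0 ≤ k s) {R r₁ r₂ : ℝ}
    (hr₁ : 0 < r₁) (hr₂ : 0 < r₂) (h1 : r₁ ≤ R) (h2 : r₂ ≤ R)
    {f g : EuclideanSpace ℝ (Fin n) → ℝ} (hf : Adm R r₁ f) (hg : Adm R r₂ g) :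
    J k f g ≤ J k (ib n r₁) (ib n r₂) := by
  set S : Set ENNReal := {d | ∃ f' g' : EuclideanSpace ℝ (Fin n) → ℝ, Adm R r₁ f' ∧ Adm R r₂ g' ∧
    J k f g ≤ J k f' g' ∧ d = delta r₁ f' + delta r₂ g'} with hS
  have hne : S.Nonempty := ⟨_, f, g, hf, hg, le_rfl, rfl⟩
  have dfin : ∀ {r : ℝ} {h : EuclideanSpace ℝ (Fin n) → ℝ}, Adm R r h → delta r h ≠ ⊤ := by
    intro r h hh
    refine ne_top_of_le_ne_top (measure_ball_lt_top (μ := volume)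
      (x := (0 : EuclideanSpace ℝ (Fin n))) (r := r)).ne (le_trans ?_ hh.mass)
    refine lintegral_mono fun x => ENNReal.ofReal_le_ofReal ?_
    unfold q; split_ifs; exacts [hh.nonneg x, le_rfl]
  have hinf : sInf S = 0 := by
    by_contra hd
    have hd2 : sInf S / 2 ≠ 0 := by simp [hd]
    have hfin : sInf S ≠ ⊤ := ne_top_of_le_ne_top (ENNReal.add_ne_top.2 ⟨dfin hf, dfin hg⟩)
      (sInf_le ⟨f, g, hf, hg, le_rfl, rfl⟩)
    obtain ⟨γ₁, hγ₁, H1⟩ := uniform_gain (n := n) hr₁ h1 hd2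
    obtain ⟨γ₂, hγ₂, H2⟩ := uniform_gain (n := n) hr₂ h2 hd2
    have hγ : min γ₁ γ₂ ≠ 0 := by
      rcases min_choice γ₁ γ₂ with h | h <;> rw [h] <;> assumption
    obtain ⟨d, ⟨f', g', hf', hg', hJ, rfl⟩, hlt⟩ :=
      exists_lt_of_csInf_lt hne (ENNReal.lt_add_right hfin hγ)
    have hle : sInf S ≤ delta r₁ f' + delta r₂ g' := sInf_le ⟨f', g', hf', hg', hJ, rfl⟩
    have hv : ∃ v, v ≠ 0 ∧ min γ₁ γ₂ ≤ G r₁ f' v + G r₂ g' v := by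
      by_cases hc : sInf S / 2 ≤ delta r₁ f'
      · obtain ⟨v, hv0, hv⟩ := H1 f' hf' hc
        exact ⟨v, hv0, (min_le_left _ _).trans (hv.trans le_self_add)⟩
      · have : sInf S / 2 ≤ delta r₂ g' := by
          by_contra hc2
          have := ENNReal.add_lt_add (not_le.1 hc) (not_le.1 hc2)
          rw [ENNReal.add_halves] at this
          exact absurd hle (not_le.2 this)
        obtain ⟨v, hv0, hv⟩ := H2 g' hg' this
        exact ⟨v, hv0, (min_le_right _ _).trans (hv.trans le_add_self)⟩
    obtain ⟨v, hv0, hv⟩ := hv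
    have hm : sInf S ≤ delta r₁ (T v f') + delta r₂ (T v g') :=
      sInf_le ⟨T v f', T v g', T_adm hf' hv0, T_adm hg' hv0, hJ.trans
        (J_T hk hk0 hv0 hf'.meas hg'.meas hf'.nonneg hf'.le_one hg'.nonneg hg'.le_one), rfl⟩
    have : sInf S + min γ₁ γ₂ ≤ delta r₁ f' + delta r₂ g' := by
      calc _ ≤ delta r₁ (T v f') + delta r₂ (T v g') + (G r₁ f' v + G r₂ g' v) := by gcongr
        _ = (delta r₁ (T v f') + G r₁ f' v) + (delta r₂ (T v g') + G r₂ g' v) := by ring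
        _ ≤ _ := add_le_add (gain hf' hv0) (gain hg' hv0)
    exact absurd hlt (not_lt.2 this)
  set M := ENNReal.ofReal (k 0) * (volume (Metric.ball (0 : EuclideanSpace ℝ (Fin n)) r₂) +
       volume (Metric.ball (0 : EuclideanSpace ℝ (Fin n)) r₁)) with hM
  have hMfin : M ≠ ⊤ := ENNReal.mul_ne_top ENNReal.ofReal_ne_top
    (ENNReal.add_ne_top.2 ⟨measure_ball_lt_top.ne, measure_ball_lt_top.ne⟩)
  refine ENNReal.le_of_forall_pos_le_add fun ε hε _ => ?_
  obtain ⟨η, hη, hη2⟩ := ENNReal.exists_nnreal_pos_mul_lt (a := M) (b := ε) hMfin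
    (by exact_mod_cast hε.ne')
  obtain ⟨d, ⟨f', g', hf', hg', hJ, rfl⟩, hlt⟩ :=
    exists_lt_of_csInf_lt hne (b := (η : ENNReal)) (by rw [hinf]; exact_mod_cast hη)
  refine hJ.trans ((J_err hk hk0 hf' hg').trans ?_)
  gcongr
  refine le_trans ?_ hη2.le
  rw [mul_comm (η : ENNReal)]
  gcongr

lemma riesz {k : ℝ → ℝ} (hk : Antitone k) (hk0 : ∀ s, 0 ≤ k s) {r₁ r₂ : ℝ}
    (hr₁ : 0 < r₁) (hr₂ : 0 < r₂)
    {f g : EuclideanSpace ℝ (Fin n) → ℝ} (hf : Measurable f) (hg : Measurable g)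
    (f0 : ∀ x, 0 ≤ f x) (f1 : ∀ x, f x ≤ 1) (g0 : ∀ x, 0 ≤ g x) (g1 : ∀ x, g x ≤ 1)
    (mf : ∫⁻ x, ENNReal.ofReal (f x) ≤ volume (Metric.ball (0 : EuclideanSpace ℝ (Fin n)) r₁))
    (mg : ∫⁻ x, ENNReal.ofReal (g x) ≤ volume (Metric.ball (0 : EuclideanSpace ℝ (Fin n)) r₂)) :
    J k f g ≤ J k (ib n r₁) (ib n r₂) := by
  let t : ℕ → (EuclideanSpace ℝ (Fin n) → ℝ) → EuclideanSpace ℝ (Fin n) → ℝ :=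
    fun N h => (Metric.ball (0 : EuclideanSpace ℝ (Fin n)) (max (max r₁ r₂) N)).indicator h
  have adm : ∀ (N : ℕ) (r : ℝ) (h : EuclideanSpace ℝ (Fin n) → ℝ), Measurable h → (∀ x, 0 ≤ h x) →
      (∀ x, h x ≤ 1) →
      ∫⁻ x, ENNReal.ofReal (h x) ≤ volume (Metric.ball (0 : EuclideanSpace ℝ (Fin n)) r) →
      Adm (max (max r₁ r₂) N) r (t N h) := by
    intro N r h hm h0 h1 hms
    refine ⟨hm.indicator measurableSet_ball, fun x => Set.indicator_nonneg (fun _ _ => h0 _) x,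
      fun x => Set.indicator_le' (fun _ _ => h1 _) (fun _ _ => zero_le_one) x,
      fun x hx => Set.indicator_of_notMem (by simpa using hx) _, le_trans ?_ hms⟩
    refine lintegral_mono fun x => ENNReal.ofReal_le_ofReal ?_
    exact Set.indicator_le_self' (fun _ _ => h0 _) x
  have hN : ∀ N, J k (t N f) (t N g) ≤ J k (ib n r₁) (ib n r₂) := fun N =>
    riesz_bdd hk hk0 hr₁ hr₂ ((le_max_left _ _).trans (le_max_left _ _))
      ((le_max_right _ _).trans (le_max_left _ _)) (adm N r₁ f hf f0 f1 mf) (adm N r₂ g hg g0 g1 mg)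
  have ev : ∀ (h : EuclideanSpace ℝ (Fin n) → ℝ) x, ∀ᶠ N : ℕ in Filter.atTop, t N h x = h x := by
    intro h x
    obtain ⟨N0, hN0⟩ := exists_nat_gt ‖x‖
    filter_upwards [Filter.eventually_ge_atTop N0] with N hNN
    refine Set.indicator_of_mem (mem_ball_zero_iff.2 ?_) _
    have : (N0 : ℝ) ≤ N := by exact_mod_cast hNN
    exact (hN0.trans_le this).trans_le (le_max_right _ _)
  have lim : ∀ p : EuclideanSpace ℝ (Fin n) × EuclideanSpace ℝ (Fin n),
      Filter.liminf (fun N => ENNReal.ofReal (t N f p.1 * t N g p.2 * k ‖p.1 - p.2‖)) Filter.atTop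
      = ENNReal.ofReal (f p.1 * g p.2 * k ‖p.1 - p.2‖) := by
    intro p
    refine Filter.Tendsto.liminf_eq (tendsto_const_nhds.congr' ?_)
    filter_upwards [ev f p.1, ev g p.2] with N h1 h2
    rw [h1, h2]
  unfold J
  simp_rw [← lim]
  refine (lintegral_liminf_le fun N => J_meas hk (adm N r₁ f hf f0 f1 mf).meas
    (adm N r₂ g hg g0 g1 mg).meas).trans ?_
  exact Filter.liminf_le_of_le (by isBoundedDefault) fun b hb => by
    obtain ⟨N, h⟩ := hb.exists
    exact h.trans (hN N)

lemma mass_div {n : ℕ} {k l r : ℝ} (hk : 0 < k) (hl : 0 < l)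
    (hB : volume (Metric.ball (0 : EuclideanSpace ℝ (Fin n)) r) = ENNReal.ofReal (l / k))
    {f : EuclideanSpace ℝ (Fin n) → ℝ}
    (hm : ∫⁻ x, ENNReal.ofReal (f x) ≤ ENNReal.ofReal l) :
    ∫⁻ x, ENNReal.ofReal (f x / k) ≤ volume (Metric.ball (0 : EuclideanSpace ℝ (Fin n)) r) := by
  rw [hB]
  simp_rw [div_eq_mul_inv, ENNReal.ofReal_mul' (inv_pos.2 hk).le]
  rw [lintegral_mul_const' _ _ ENNReal.ofReal_ne_top]
  gcongr

end RieszBalls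

theorem balls_maximize_riesz_functional
    (n : ℕ) (hn : 1 ≤ n)
    (k₁ k₂ ℓ₁ ℓ₂ : ℝ) (hk₁ : 0 < k₁) (hk₂ : 0 < k₂) (hℓ₁ : 0 < ℓ₁) (hℓ₂ : 0 < ℓ₂)
    (j : ℝ → ℝ) (hj0 : ∀ s : ℝ, 0 ≤ s → 0 ≤ j s)
    (hj : ∀ s t : ℝ, 0 ≤ s → s ≤ t → j t ≤ j s)
    (Ψ : ℝ → ℝ → ℝ)
    (hΨ1 : ∀ s : ℝ, 0 ≤ s → Ψ s 0 = 0 ∧ Ψ 0 s = 0)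
    (hΨ2 : ∀ a b c d : ℝ, 0 ≤ a → a ≤ b → 0 ≤ c → c ≤ d →
      Ψ a d + Ψ b c ≤ Ψ b d + Ψ a c)
    (hΨ3a : ∀ x : ℝ, 0 ≤ x → ∀ b₁ b₂ : ℝ, 0 ≤ b₁ → b₁ ≤ b₂ → ∀ t : ℝ, 0 < t → t < 1 →
      Ψ (t * x) b₂ - t * Ψ x b₂ - Ψ (t * x) b₁ + t * Ψ x b₁ ≤ 0)
    (hΨ3b : ∀ y : ℝ, 0 ≤ y → ∀ a₁ a₂ : ℝ, 0 ≤ a₁ → a₁ ≤ a₂ → ∀ t : ℝ, 0 < t → t < 1 →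
      Ψ a₂ (t * y) - t * Ψ a₂ y - Ψ a₁ (t * y) + t * Ψ a₁ y ≤ 0)
    (hΨcont1 : ∀ s₂ : ℝ, 0 ≤ s₂ → ContinuousOn (fun s₁ => Ψ s₁ s₂) (Set.Ici 0))
    (hΨcont2 : ∀ s₁ : ℝ, 0 ≤ s₁ → ContinuousOn (fun s₂ => Ψ s₁ s₂) (Set.Ici 0))
    (hΨac1 : ∃ G : ℝ → ℝ → ℝ, ∀ s₂ s₁ : ℝ, 0 ≤ s₁ →
      IntervalIntegrable (G s₂) volume 0 s₁ ∧ Ψ s₁ s₂ = ∫ u in (0:ℝ)..s₁, G s₂ u)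
    (hΨac2 : ∃ F : ℝ → ℝ → ℝ, ∀ s₁ s₂ : ℝ, 0 ≤ s₂ →
      IntervalIntegrable (F s₁) volume 0 s₂ ∧ Ψ s₁ s₂ = ∫ u in (0:ℝ)..s₂, F s₁ u)
    (r₁ r₂ : ℝ) (hr₁ : 0 < r₁) (hr₂ : 0 < r₂)
    (hB₁ : volume (Metric.ball (0 : EuclideanSpace ℝ (Fin n)) r₁) = ENNReal.ofReal (ℓ₁ / k₁))
    (hB₂ : volume (Metric.ball (0 : EuclideanSpace ℝ (Fin n)) r₂) = ENNReal.ofReal (ℓ₂ / k₂))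
    (f₁ f₂ : EuclideanSpace ℝ (Fin n) → ℝ)
    (hf₁m : Measurable f₁) (hf₂m : Measurable f₂)
    (hf₁ : ∀ x, 0 ≤ f₁ x ∧ f₁ x ≤ k₁) (hf₂ : ∀ x, 0 ≤ f₂ x ∧ f₂ x ≤ k₂)
    (hf₁ℓ : ∫⁻ x, ENNReal.ofReal (f₁ x) ≤ ENNReal.ofReal ℓ₁)
    (hf₂ℓ : ∫⁻ x, ENNReal.ofReal (f₂ x) ≤ ENNReal.ofReal ℓ₂) :
    ∫⁻ x, ∫⁻ y, ENNReal.ofReal (Ψ (f₁ x) (f₂ y) * j ‖x - y‖) ≤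
      ∫⁻ x, ∫⁻ y, ENNReal.ofReal
        (Ψ (k₁ * (Metric.ball (0 : EuclideanSpace ℝ (Fin n)) r₁).indicator (fun _ => (1:ℝ)) x)
           (k₂ * (Metric.ball (0 : EuclideanSpace ℝ (Fin n)) r₂).indicator (fun _ => (1:ℝ)) y)
          * j ‖x - y‖) := by
  classical
  have hM : 0 ≤ Ψ k₁ k₂ := by
    have := hΨ2 0 k₁ 0 k₂ le_rfl hk₁.le le_rfl hk₂.le
    rw [(hΨ1 k₂ hk₂.le).2, (hΨ1 k₁ hk₁.le).1, (hΨ1 0 le_rfl).1] at this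
    linarith
  have s1 : ∀ a b : ℝ, 0 ≤ a → a ≤ k₁ → 0 ≤ b → Ψ a b ≤ a / k₁ * Ψ k₁ b := by
    intro a b ha hak hb
    rcases ha.eq_or_lt with h | h
    · rw [← h, (hΨ1 b hb).2]; simp
    rcases hak.eq_or_lt with h' | h'
    · rw [h']; field_simp; exact le_rfl
    have := hΨ3a k₁ hk₁.le 0 b le_rfl hb (a / k₁) (by positivity) ((div_lt_one hk₁).2 h')
    rw [div_mul_cancel₀ _ hk₁.ne', (hΨ1 a ha).1, (hΨ1 k₁ hk₁.le).1] at this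
    linarith
  have s2 : ∀ b : ℝ, 0 ≤ b → b ≤ k₂ → Ψ k₁ b ≤ b / k₂ * Ψ k₁ k₂ := by
    intro b hb hbk
    rcases hb.eq_or_lt with h | h
    · rw [← h, (hΨ1 k₁ hk₁.le).1]; simp
    rcases hbk.eq_or_lt with h' | h'
    · rw [h']; field_simp; exact le_rfl
    have := hΨ3b k₂ hk₂.le 0 k₁ le_rfl hk₁.le (b / k₂) (by positivity) ((div_lt_one hk₂).2 h')
    rw [div_mul_cancel₀ _ hk₂.ne', (hΨ1 b hb).2, (hΨ1 k₂ hk₂.le).2] at this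
    linarith
  let k : ℝ → ℝ := fun s => Ψ k₁ k₂ * j (max s 0)
  have hk : Antitone k := fun s t hst => mul_le_mul_of_nonneg_left
    (hj _ _ (le_max_right _ _) (max_le_max_right 0 hst)) hM
  have hk0 : ∀ s, 0 ≤ k s := fun s => mul_nonneg hM (hj0 _ (le_max_right _ _))
  have kn : ∀ x : EuclideanSpace ℝ (Fin n), k ‖x‖ = Ψ k₁ k₂ * j ‖x‖ := fun x => by
    simp only [k]; rw [max_eq_left (norm_nonneg x)]
  have hg1 : Measurable (fun x => f₁ x / k₁) := hf₁m.div_const _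
  have hg2 : Measurable (fun x => f₂ x / k₂) := hf₂m.div_const _
  have main := RieszBalls.riesz (n := n) hk hk0 hr₁ hr₂ hg1 hg2
    (fun x => div_nonneg (hf₁ x).1 hk₁.le) (fun x => (div_le_one hk₁).2 (hf₁ x).2)
    (fun x => div_nonneg (hf₂ x).1 hk₂.le) (fun x => (div_le_one hk₂).2 (hf₂ x).2)
    (RieszBalls.mass_div hk₁ hℓ₁ hB₁ hf₁ℓ) (RieszBalls.mass_div hk₂ hℓ₂ hB₂ hf₂ℓ)
  unfold RieszBalls.J at main
  rw [lintegral_prod _ (RieszBalls.J_meas hk hg1 hg2).aemeasurable,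
    lintegral_prod _ (RieszBalls.J_meas hk (RieszBalls.ib_meas r₁)
      (RieszBalls.ib_meas r₂)).aemeasurable] at main
  refine le_trans ?_ (main.trans ?_)
  · refine lintegral_mono fun x => lintegral_mono fun y => ENNReal.ofReal_le_ofReal ?_
    simp only [kn]
    have h1 := s1 (f₁ x) (f₂ y) (hf₁ x).1 (hf₁ x).2 (hf₂ y).1
    have h2 := s2 (f₂ y) (hf₂ y).1 (hf₂ y).2
    have h3 : Ψ (f₁ x) (f₂ y) ≤ f₁ x / k₁ * (f₂ y / k₂ * Ψ k₁ k₂) :=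
      h1.trans (mul_le_mul_of_nonneg_left h2 (div_nonneg (hf₁ x).1 hk₁.le))
    calc _ ≤ f₁ x / k₁ * (f₂ y / k₂ * Ψ k₁ k₂) * j ‖x - y‖ :=
          mul_le_mul_of_nonneg_right h3 (hj0 _ (norm_nonneg _))
      _ = _ := by ring
  · refine lintegral_mono fun x => lintegral_mono fun y => ENNReal.ofReal_le_ofReal (le_of_eq ?_)
    simp only [kn, RieszBalls.ib]
    by_cases hx : x ∈ Metric.ball (0 : EuclideanSpace ℝ (Fin n)) r₁
    · by_cases hy : y ∈ Metric.ball (0 : EuclideanSpace ℝ (Fin n)) r₂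
      · rw [Set.indicator_of_mem hx, Set.indicator_of_mem hy]; simp
      · rw [Set.indicator_of_notMem hy, Set.indicator_of_mem hx]
        simp [(hΨ1 k₁ hk₁.le).1]
    · rw [Set.indicator_of_notMem hx]
      have : 0 ≤ k₂ * (Metric.ball (0 : EuclideanSpace ℝ (Fin n)) r₂).indicator
          (fun _ => (1:ℝ)) y :=
        mul_nonneg hk₂.le (Set.indicator_nonneg (fun _ _ => zero_le_one) y)
      rw [mul_zero, (hΨ1 _ this).2]; simp
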